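/- Let r, s, q be nonzero complex numbers with r s^{−1} = q². Then the three algebras U⁺_{r,s}, U⁺_{q²,1}, and U⁺_{q,q^{−1}} are pairwise 2-cocycle deformations of each other: for each pair among them there is a 2-cocycle ψ of Q with values in ℂˣ of the form ψ(μ,ν) = t^{⟨μ,ν⟩} for some t ∈ ℂˣ, and an isomorphism of Q⁺-graded ℂ-algebras from the first algebra onto the cocycle deformation of the second by ψ, sending e_i to e_i. -/

import Mathlib

noncomputable section

/-- The q-integer `(m)_v = 1 + v + ⋯ + v^{m-1}`. -/
def qnat {K : Type} [CommRing K] (v : K) (m : ℕ) : K := ∑ i ∈ Finset.range m, v ^ i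

/-- The Gaussian binomial coefficient `binom(m,k)_v`, as a polynomial expression in `v`
(defined through the Pascal-type recurrence). -/
def qbinom {K : Type} [CommRing K] (v : K) : ℕ → ℕ → K
  | _, 0 => 1
  | 0, _ + 1 => 0
  | m + 1, k + 1 => qbinom v m k + v ^ (k + 1) * qbinom v m (k + 1)

/-- The Euler (Ringel) form on basis elements: `⟨α_i, α_j⟩ = d_i a_{ij}` if `i < j`,
`d_i` if `i = j`, and `0` if `i > j`. -/
def eulB {n : ℕ} (a : Fin n → Fin n → ℤ) (d : Fin n → ℤ) (i j : Fin n) : ℤ :=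
  if i < j then d i * a i j else if i = j then d i else 0

/-- The Euler form on the root lattice `Q = Fin n → ℤ` (coordinates in the basis `α_i`). -/
def euler {n : ℕ} (a : Fin n → Fin n → ℤ) (d : Fin n → ℤ) (μ ν : Fin n → ℤ) : ℤ :=
  ∑ i, ∑ j, μ i * ν j * eulB a d i j

/-- The coefficient `c^{(k)}_{ij} = (r_i s_i⁻¹)^{k(k-1)/2} r^{k⟨α_j,α_i⟩} s^{-k⟨α_i,α_j⟩}`. -/
def ccoef {K : Type} [Field K] {n : ℕ} (a : Fin n → Fin n → ℤ) (d : Fin n → ℤ)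
    (r s : K) (i j : Fin n) (k : ℕ) : K :=
  (r ^ d i * (s ^ d i)⁻¹) ^ (k * (k - 1) / 2) *
    r ^ ((k : ℤ) * eulB a d j i) * (s ^ ((k : ℤ) * eulB a d i j))⁻¹

/-- The `(r,s)`-Serre element
`∑_{k=0}^{1-a_{ij}} (-1)^k binom(1-a_{ij},k)_{r_i s_i⁻¹} c^{(k)}_{ij} E_i^{1-a_{ij}-k} E_j E_i^k`. -/
def serreElt {K : Type} [Field K] {n : ℕ} (a : Fin n → Fin n → ℤ) (d : Fin n → ℤ)
    (r s : K) {A : Type} [Ring A] [Algebra K A] (E : Fin n → A) (i j : Fin n) : A :=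
  ∑ k ∈ Finset.range ((1 - a i j).toNat + 1),
    ((-1 : K) ^ k * qbinom (r ^ d i * (s ^ d i)⁻¹) ((1 - a i j).toNat) k *
        ccoef a d r s i j k) •
      (E i ^ ((1 - a i j).toNat - k) * E j * E i ^ k)

/-- The defining relations of `U⁺_{r,s}`: the `(r,s)`-Serre relations. -/
inductive SerreRel (K : Type) [Field K] {n : ℕ} (a : Fin n → Fin n → ℤ) (d : Fin n → ℤ)
    (r s : K) : FreeAlgebra K (Fin n) → FreeAlgebra K (Fin n) → Prop
  | rel (i j : Fin n) (h : i ≠ j) :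
      SerreRel K a d r s (serreElt a d r s (FreeAlgebra.ι K) i j) 0

/-- `U⁺_{r,s}`: the algebra generated by the `e_i` subject only to the `(r,s)`-Serre
relations. -/
abbrev Uplus (K : Type) [Field K] {n : ℕ} (a : Fin n → Fin n → ℤ) (d : Fin n → ℤ)
    (r s : K) : Type := RingQuot (SerreRel K a d r s)

/-- The generator `e_i` of `U⁺_{r,s}`. -/
def eP (K : Type) [Field K] {n : ℕ} (a : Fin n → Fin n → ℤ) (d : Fin n → ℤ)
    (r s : K) (i : Fin n) : Uplus K a d r s :=
  RingQuot.mkAlgHom K (SerreRel K a d r s) (FreeAlgebra.ι K i)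

/-- The degree-`μ` homogeneous component of `U⁺_{r,s}` for `μ ∈ Q⁺`: the span of the
monomials in the `e_i` in which `e_i` occurs exactly `μ i` times. -/
def UplusDeg (K : Type) [Field K] {n : ℕ} (a : Fin n → Fin n → ℤ) (d : Fin n → ℤ)
    (r s : K) (μ : Fin n → ℕ) : Submodule K (Uplus K a d r s) :=
  Submodule.span K
    {x | ∃ w : List (Fin n), (∀ i, w.count i = μ i) ∧ x = (w.map (eP K a d r s)).prod}


/-- `Φ : U⁺_{r,s} → (U⁺_{r',s'})^ψ` is an isomorphism of `Q⁺`-graded `ℂ`-algebras onto the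
cocycle deformation of `U⁺_{r',s'}` by the bicharacter `ψ(μ,ν) = t^{⟨μ,ν⟩}`, sending
`e_i` to `e_i`. -/
def IsGradedTwistIso {n : ℕ} (a : Fin n → Fin n → ℤ) (d : Fin n → ℤ)
    (t r s r' s' : ℂ) : Prop :=
  ∃ Φ : Uplus ℂ a d r s ≃ₗ[ℂ] Uplus ℂ a d r' s',
    (∀ i, Φ (eP ℂ a d r s i) = eP ℂ a d r' s' i) ∧
    Φ 1 = 1 ∧
    (∀ (μ ν : Fin n → ℕ) (x y : Uplus ℂ a d r s),
        x ∈ UplusDeg ℂ a d r s μ → y ∈ UplusDeg ℂ a d r s ν →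
        Φ (x * y) =
          (t ^ euler a d (fun i => (μ i : ℤ)) (fun i => (ν i : ℤ))) • (Φ x * Φ y)) ∧
    (∀ μ : Fin n → ℕ,
        Submodule.map Φ.toLinearMap (UplusDeg ℂ a d r s μ) = UplusDeg ℂ a d r' s' μ)

section Twist

variable {K : Type} [Field K] {n : ℕ} (a : Fin n → Fin n → ℤ) (d : Fin n → ℤ)

theorem map_serreElt {A B : Type} [Ring A] [Algebra K A] [Ring B] [Algebra K B]
    (f : A →ₐ[K] B) (r s : K) (E : Fin n → A) (i j : Fin n) :
    f (serreElt a d r s E i j) = serreElt a d r s (fun k => f (E k)) i j := by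
  simp [serreElt, map_sum]

theorem mulLeft_serreElt {A : Type} [Ring A] [Algebra K A] (r s : K) (E : Fin n → A)
    (i j : Fin n) :
    LinearMap.mulLeft K (serreElt a d r s E i j) =
      serreElt a d r s (fun k => LinearMap.mulLeft K (E k)) i j :=
  map_serreElt a d (Algebra.lmul K A) r s E i j

theorem serreElt_smul {A : Type} [Ring A] [Algebra K A] (r s : K) (c : Fin n → K)
    (E : Fin n → A) (i j : Fin n) :
    serreElt a d r s (fun k => c k • E k) i j =
      (c i ^ (1 - a i j).toNat * c j) • serreElt a d r s E i j := by
  unfold serreElt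
  rw [Finset.smul_sum]
  refine Finset.sum_congr rfl fun k hk => ?_
  have hk : k ≤ (1 - a i j).toNat := by simpa [Nat.lt_succ_iff] using hk
  obtain ⟨l, hl⟩ := Nat.exists_eq_add_of_le hk
  simp only [hl, Nat.add_sub_cancel_left, smul_pow, smul_mul_assoc, mul_smul_comm, smul_smul]
  congr 1
  ring

theorem serreElt_eP (r s : K) {i j : Fin n} (h : i ≠ j) :
    serreElt a d r s (eP K a d r s) i j = 0 := by
  have := RingQuot.mkAlgHom_rel K (SerreRel.rel (K := K) (a := a) (d := d) (r := r) (s := s) i j h)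
  rwa [map_serreElt, map_zero] at this

/-- The algebra homomorphism out of `U⁺_{r,s}` determined by elements satisfying the
`(r,s)`-Serre relations. -/
def uplusLift (r s : K) {A : Type} [Ring A] [Algebra K A] (E : Fin n → A)
    (hE : ∀ i j, i ≠ j → serreElt a d r s E i j = 0) : Uplus K a d r s →ₐ[K] A :=
  RingQuot.liftAlgHom K ⟨FreeAlgebra.lift K E, by
    rintro _ _ ⟨i, j, h⟩
    rw [map_serreElt, map_zero]
    simpa using hE i j h⟩

@[simp]
theorem uplusLift_eP (r s : K) {A : Type} [Ring A] [Algebra K A] (E : Fin n → A)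
    (hE : ∀ i j, i ≠ j → serreElt a d r s E i j = 0) (i : Fin n) :
    uplusLift a d r s E hE (eP K a d r s i) = E i := by
  simp [uplusLift, eP]

theorem uplus_linearMap_ext (r s : K) {M : Type} [AddCommGroup M] [Module K M]
    {f g : Uplus K a d r s →ₗ[K] M}
    (h : ∀ w : List (Fin n), f (w.map (eP K a d r s)).prod = g (w.map (eP K a d r s)).prod) :
    f = g := by
  have key : f ∘ₗ (RingQuot.mkAlgHom K (SerreRel K a d r s)).toLinearMap =
      g ∘ₗ (RingQuot.mkAlgHom K (SerreRel K a d r s)).toLinearMap := by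
    refine (FreeAlgebra.basisFreeMonoid K (Fin n)).ext fun w => ?_
    have hw : FreeAlgebra.basisFreeMonoid K (Fin n) w =
        ((FreeMonoid.toList w).map (FreeAlgebra.ι K)).prod := by
      simp [FreeAlgebra.basisFreeMonoid, FreeAlgebra.equivMonoidAlgebraFreeMonoid,
        FreeMonoid.lift_apply]
    simp only [LinearMap.comp_apply, hw, AlgHom.toLinearMap_apply, map_list_prod, List.map_map]
    exact h _
  ext x
  obtain ⟨y, rfl⟩ := RingQuot.mkAlgHom_surjective K (SerreRel K a d r s) x
  exact LinearMap.congr_fun key y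

theorem uplus_algHom_ext (r s : K) {A : Type} [Ring A] [Algebra K A]
    {f g : Uplus K a d r s →ₐ[K] A} (h : ∀ i, f (eP K a d r s i) = g (eP K a d r s i)) :
    f = g := by
  apply AlgHom.toLinearMap_injective
  refine uplus_linearMap_ext a d r s fun w => ?_
  simp only [AlgHom.toLinearMap_apply, map_list_prod, List.map_map]
  congr 2
  ext i
  exact h i

/-- The Euler form on a pair of words. -/
def eulerWord (w v : List (Fin n)) : ℤ :=
  (w.map fun i => (v.map (eulB a d i)).sum).sum

/-- The sum of the Euler form over all pairs of letters of a word, taken in order. -/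
def wordWeight : List (Fin n) → ℤ
  | [] => 0
  | i :: w => (w.map (eulB a d i)).sum + wordWeight w

theorem wordWeight_append (w v : List (Fin n)) :
    wordWeight a d (w ++ v) = wordWeight a d w + wordWeight a d v + eulerWord a d w v := by
  induction w with
  | nil => simp [wordWeight, eulerWord]
  | cons i w ih =>
    simp only [List.cons_append, wordWeight, ih, List.map_append, List.sum_append, eulerWord,
      List.map_cons, List.sum_cons]
    ring

theorem list_sum_map_eq_sum_count (w : List (Fin n)) (f : Fin n → ℤ) :
    (w.map f).sum = ∑ i, (w.count i : ℤ) * f i := by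
  induction w with
  | nil => simp
  | cons k w ih =>
    simp [ih, List.count_cons, add_mul, Finset.sum_add_distrib, add_comm]

theorem eulerWord_eq_euler (w v : List (Fin n)) :
    eulerWord a d w v = euler a d (fun i => (w.count i : ℤ)) (fun i => (v.count i : ℤ)) := by
  simp only [eulerWord, euler, list_sum_map_eq_sum_count, Finset.mul_sum, mul_assoc]

theorem wordWeight_serre (i j : Fin n) (k l : ℕ) :
    wordWeight a d (List.replicate l i ++ j :: List.replicate k i) =
      wordWeight a d (List.replicate (l + k) i) + (l : ℤ) * eulB a d i j +
        (k : ℤ) * eulB a d j i := by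
  rw [List.replicate_add, wordWeight_append, wordWeight_append]
  simp [wordWeight, eulerWord]
  ring

/-- The automorphism `e_j ↦ t^{⟨α_i, α_j⟩} e_j` of `U⁺_{r,s}`. -/
def torusHom (t r s : K) (i : Fin n) : Uplus K a d r s →ₐ[K] Uplus K a d r s :=
  uplusLift a d r s (fun j => t ^ eulB a d i j • eP K a d r s j) fun k l h => by
    rw [serreElt_smul, serreElt_eP a d r s h, smul_zero]

@[simp]
theorem torusHom_eP (t r s : K) (i j : Fin n) :
    torusHom a d t r s i (eP K a d r s j) = t ^ eulB a d i j • eP K a d r s j := by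
  simp [torusHom]

theorem torusHom_word {t : K} (ht : t ≠ 0) (r s : K) (i : Fin n) (w : List (Fin n)) :
    torusHom a d t r s i (w.map (eP K a d r s)).prod =
      t ^ (w.map (eulB a d i)).sum • (w.map (eP K a d r s)).prod := by
  induction w with
  | nil => simp
  | cons j w ih =>
    simp [ih, zpow_add₀ ht, smul_smul, mul_comm]

/-- `torusHom` as a linear endomorphism. -/
def torusEnd (t r s : K) (i : Fin n) : Module.End K (Uplus K a d r s) :=
  (torusHom a d t r s i).toLinearMap

theorem commute_torusEnd (t r s : K) (i j : Fin n) :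
    Commute (torusEnd a d t r s i) (torusEnd a d t r s j) := by
  have h : (torusHom a d t r s i).comp (torusHom a d t r s j) =
      (torusHom a d t r s j).comp (torusHom a d t r s i) :=
    uplus_algHom_ext a d r s fun k => by simp [smul_smul, mul_comm]
  exact congrArg AlgHom.toLinearMap h

/-- Twisted left multiplication by a generator: `x ↦ e_i · (D_i x)`, with `D_i` the torus
automorphism attached to `i`. -/
def twistedMul (t r s : K) (i : Fin n) : Module.End K (Uplus K a d r s) :=
  LinearMap.mulLeft K (eP K a d r s i) * torusEnd a d t r s i

theorem twistedMul_word {t : K} (ht : t ≠ 0) (r s : K) (w : List (Fin n)) :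
    (w.map (twistedMul a d t r s)).prod =
      t ^ wordWeight a d w • (LinearMap.mulLeft K (w.map (eP K a d r s)).prod *
        (w.map (torusEnd a d t r s)).prod) := by
  induction w with
  | nil => ext x; simp [wordWeight]
  | cons i w ih =>
    ext x
    simp only [List.map_cons, List.prod_cons, ih, twistedMul, wordWeight, zpow_add₀ ht,
      Module.End.mul_apply, LinearMap.smul_apply, LinearMap.mulLeft_apply, map_smul]
    simp only [torusEnd, AlgHom.toLinearMap_apply, map_mul, torusHom_word a d ht, smul_mul_assoc,
      mul_smul_comm, smul_smul, mul_assoc]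
    rw [mul_comm]

theorem qbase_twist {r s r' s' x : K} (hx : x ≠ 0) (hr : r = r' * x) (hs : s = s' * x)
    (e : ℤ) : r ^ e * (s ^ e)⁻¹ = r' ^ e * (s' ^ e)⁻¹ := by
  have := zpow_ne_zero e hx
  rw [hr, hs, mul_zpow, mul_zpow, mul_inv]
  field_simp

theorem ccoef_twist {r s r' s' x : K} (hx : x ≠ 0) (hr : r = r' * x) (hs : s = s' * x)
    (i j : Fin n) (k : ℕ) :
    ccoef a d r s i j k * x⁻¹ ^ ((k : ℤ) * eulB a d j i) =
      ccoef a d r' s' i j k * x⁻¹ ^ ((k : ℤ) * eulB a d i j) := by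
  rw [ccoef, ccoef, qbase_twist hx hr hs, hr, hs]
  have h1 := zpow_ne_zero ((k : ℤ) * eulB a d j i) hx
  have h2 := zpow_ne_zero ((k : ℤ) * eulB a d i j) hx
  simp only [mul_zpow r', mul_zpow s', inv_zpow, mul_inv]
  field_simp

theorem serreElt_twistedMul {r s r' s' x : K} (hx : x ≠ 0) (hr : r = r' * x) (hs : s = s' * x)
    {i j : Fin n} (hij : i ≠ j) :
    serreElt a d r s (twistedMul a d x⁻¹ r' s') i j = 0 := by
  have hx' : x⁻¹ ≠ 0 := inv_ne_zero hx
  set m := (1 - a i j).toNat with hm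
  set D := torusEnd a d x⁻¹ r' s'
  have key : serreElt a d r s (twistedMul a d x⁻¹ r' s') i j =
      x⁻¹ ^ (wordWeight a d (List.replicate m i) + (m : ℤ) * eulB a d i j) •
        (LinearMap.mulLeft K (serreElt a d r' s' (eP K a d r' s') i j) * (D i ^ m * D j)) := by
    rw [mulLeft_serreElt]
    unfold serreElt
    rw [Finset.sum_mul, Finset.smul_sum]
    refine Finset.sum_congr rfl fun k hk => ?_
    have hk : k ≤ m := by simpa [Nat.lt_succ_iff] using hk
    obtain ⟨l, hl⟩ := Nat.exists_eq_add_of_le' hk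
    have hw := twistedMul_word a d hx' r' s' (List.replicate l i ++ j :: List.replicate k i)
    have hD : D i ^ l * (D j * D i ^ k) = D i ^ m * D j := by
      rw [((commute_torusEnd a d x⁻¹ r' s' i j).pow_left k).eq.symm, ← mul_assoc, ← pow_add, hl]
    have hmul : LinearMap.mulLeft K (eP K a d r' s' i ^ l *
        (eP K a d r' s' j * eP K a d r' s' i ^ k)) =
        LinearMap.mulLeft K (eP K a d r' s' i) ^ l * LinearMap.mulLeft K (eP K a d r' s' j) *
          LinearMap.mulLeft K (eP K a d r' s' i) ^ k := by
      rw [LinearMap.pow_mulLeft, LinearMap.pow_mulLeft, LinearMap.mulLeft_mul,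
        LinearMap.mulLeft_mul]
      rfl
    simp only [List.map_append, List.map_cons, List.map_replicate, List.prod_append,
      List.prod_cons, List.prod_replicate] at hw
    rw [hD, hmul, wordWeight_serre, ← hl] at hw
    have hml : m - k = l := by omega
    rw [← hm, hml, mul_assoc (twistedMul a d x⁻¹ r' s' i ^ l), hw, smul_smul, smul_mul_assoc,
      smul_smul]
    congr 1
    rw [qbase_twist hx hr hs, zpow_add₀ hx', zpow_add₀ hx', zpow_add₀ hx']
    have hc := ccoef_twist a d hx hr hs i j k
    have hml' : (m : ℤ) * eulB a d i j = l * eulB a d i j + k * eulB a d i j := by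
      rw [hl]; push_cast; ring
    rw [hml', zpow_add₀ hx']
    linear_combination (-1 : K) ^ k * qbinom (r' ^ d i * (s' ^ d i)⁻¹) m k *
      x⁻¹ ^ wordWeight a d (List.replicate m i) * x⁻¹ ^ ((l : ℤ) * eulB a d i j) * hc
  rw [key, serreElt_eP a d r' s' hij, LinearMap.mulLeft_zero_eq_zero, zero_mul, smul_zero]

/-- The linear map `U⁺_{r,s} → U⁺_{r',s'}` rescaling each monomial by the power of `x⁻¹` given
by its weight. -/
def twistMap {r s r' s' x : K} (hx : x ≠ 0) (hr : r = r' * x) (hs : s = s' * x) :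
    Uplus K a d r s →ₗ[K] Uplus K a d r' s' :=
  (LinearMap.applyₗ (1 : Uplus K a d r' s')) ∘ₗ
    (uplusLift a d r s (twistedMul a d x⁻¹ r' s')
      fun _ _ h => serreElt_twistedMul a d hx hr hs h).toLinearMap

theorem twistMap_word {r s r' s' x : K} (hx : x ≠ 0) (hr : r = r' * x) (hs : s = s' * x)
    (w : List (Fin n)) :
    twistMap a d hx hr hs (w.map (eP K a d r s)).prod =
      x⁻¹ ^ wordWeight a d w • (w.map (eP K a d r' s')).prod := by
  have h1 : (w.map (torusEnd a d x⁻¹ r' s')).prod 1 = 1 := by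
    induction w with
    | nil => simp
    | cons i w ih => simp [ih, torusEnd]
  have h2 : uplusLift a d r s (twistedMul a d x⁻¹ r' s')
      (fun _ _ h => serreElt_twistedMul a d hx hr hs h) (w.map (eP K a d r s)).prod =
      (w.map (twistedMul a d x⁻¹ r' s')).prod := by
    rw [map_list_prod, List.map_map]
    congr 2
    ext1 i
    simp
  simp [twistMap, h2, twistedMul_word a d (inv_ne_zero hx), h1]

theorem twistMap_comp {r s r' s' x : K} (hx : x ≠ 0) (hr : r = r' * x) (hs : s = s' * x)
    (hr' : r' = r * x⁻¹) (hs' : s' = s * x⁻¹) :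
    twistMap a d hx hr hs ∘ₗ twistMap a d (inv_ne_zero hx) hr' hs' = LinearMap.id := by
  refine uplus_linearMap_ext a d _ _ fun w => ?_
  rw [LinearMap.comp_apply, twistMap_word, map_smul, twistMap_word, smul_smul, inv_inv,
    inv_zpow, mul_inv_cancel₀ (zpow_ne_zero _ hx), one_smul, LinearMap.id_apply]

theorem twistMap_comp' {r s r' s' x : K} (hx : x ≠ 0) (hr : r = r' * x) (hs : s = s' * x)
    (hr' : r' = r * x⁻¹) (hs' : s' = s * x⁻¹) :
    twistMap a d (inv_ne_zero hx) hr' hs' ∘ₗ twistMap a d hx hr hs = LinearMap.id := by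
  refine uplus_linearMap_ext a d _ _ fun w => ?_
  rw [LinearMap.comp_apply, twistMap_word, map_smul, twistMap_word, smul_smul, inv_inv,
    inv_zpow, inv_mul_cancel₀ (zpow_ne_zero _ hx), one_smul, LinearMap.id_apply]

theorem map_twistMap_le {r s r' s' x : K} (hx : x ≠ 0) (hr : r = r' * x) (hs : s = s' * x)
    (μ : Fin n → ℕ) :
    (UplusDeg K a d r s μ).map (twistMap a d hx hr hs) ≤ UplusDeg K a d r' s' μ := by
  rw [UplusDeg, Submodule.map_span, Submodule.span_le]
  rintro _ ⟨_, ⟨w, hw, rfl⟩, rfl⟩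
  rw [twistMap_word]
  exact Submodule.smul_mem _ _ (Submodule.subset_span ⟨w, hw, rfl⟩)

theorem twistMap_mul {r s r' s' x : K} (hx : x ≠ 0) (hr : r = r' * x) (hs : s = s' * x)
    {μ ν : Fin n → ℕ} {y z : Uplus K a d r s}
    (hy : y ∈ UplusDeg K a d r s μ) (hz : z ∈ UplusDeg K a d r s ν) :
    twistMap a d hx hr hs (y * z) =
      x⁻¹ ^ euler a d (fun i => (μ i : ℤ)) (fun i => (ν i : ℤ)) •
        (twistMap a d hx hr hs y * twistMap a d hx hr hs z) := by
  unfold UplusDeg at hy hz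
  induction hy using Submodule.span_induction with
  | zero => simp
  | add y₁ y₂ _ _ h₁ h₂ => simp only [add_mul, map_add, h₁, h₂, smul_add]
  | smul c y _ h => rw [smul_mul_assoc, map_smul, map_smul, h, smul_mul_assoc, smul_comm]
  | mem y hy =>
    obtain ⟨w, hw, rfl⟩ := hy
    induction hz using Submodule.span_induction with
    | zero => simp
    | add z₁ z₂ _ _ h₁ h₂ => simp only [mul_add, map_add, h₁, h₂, smul_add]
    | smul c z _ h => rw [mul_smul_comm, map_smul, map_smul, h, mul_smul_comm, smul_comm]
    | mem z hz =>
      obtain ⟨v, hv, rfl⟩ := hz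
      rw [← List.prod_append, ← List.map_append, twistMap_word, twistMap_word, twistMap_word,
        wordWeight_append, eulerWord_eq_euler]
      simp only [hw, hv, List.map_append, List.prod_append, smul_mul_assoc, mul_smul_comm,
        smul_smul, zpow_add₀ (inv_ne_zero hx)]
      congr 1
      ring

theorem isGradedTwistIso_of_rescale {r s r' s' x : ℂ} (hx : x ≠ 0) (hr : r = r' * x)
    (hs : s = s' * x) : IsGradedTwistIso a d x⁻¹ r s r' s' := by
  have hr' : r' = r * x⁻¹ := by rw [hr, mul_inv_cancel_right₀ hx]
  have hs' : s' = s * x⁻¹ := by rw [hs, mul_inv_cancel_right₀ hx]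
  refine ⟨LinearEquiv.ofLinearMap (twistMap a d hx hr hs) (twistMap a d (inv_ne_zero hx) hr' hs')
    (twistMap_comp a d hx hr hs hr' hs') (twistMap_comp' a d hx hr hs hr' hs'),
    fun i => ?_, ?_, fun μ ν y z hy hz => twistMap_mul a d hx hr hs hy hz, fun μ => ?_⟩
  · simpa [wordWeight] using twistMap_word a d hx hr hs [i]
  · simpa [wordWeight] using twistMap_word a d hx hr hs []
  · refine le_antisymm (map_twistMap_le a d hx hr hs μ) fun y hy => ?_
    exact ⟨_, map_twistMap_le a d (inv_ne_zero hx) hr' hs' μ ⟨y, hy, rfl⟩,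
      LinearMap.congr_fun (twistMap_comp a d hx hr hs hr' hs') y⟩

theorem zpow_euler_cocycle {t : K} (ht : t ≠ 0) (μ ν lam : Fin n → ℤ) :
    t ^ euler a d μ ν * t ^ euler a d (μ + ν) lam =
      t ^ euler a d ν lam * t ^ euler a d μ (ν + lam) := by
  rw [← zpow_add₀ ht, ← zpow_add₀ ht]
  congr 1
  simp only [euler, Pi.add_apply, add_mul, mul_add, Finset.sum_add_distrib]
  ring

end Twist

/-- **Corollary 3.3(ii).** If `r s⁻¹ = q²` (with `r, s, q` nonzero complex numbers), then
`U⁺_{r,s}`, `U⁺_{q²,1}` and `U⁺_{q,q⁻¹}` are pairwise 2-cocycle deformations of each other,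
always via a 2-cocycle of the form `ψ(μ,ν) = t^{⟨μ,ν⟩}` for some nonzero `t`. -/
theorem Uplus_rs_q2_one_q_qinv_cocycle_deformations
    (n : ℕ) (a : Fin n → Fin n → ℤ) (d : Fin n → ℤ)
    (hdiag : ∀ i, a i i = 2) (hoff : ∀ i j, i ≠ j → a i j ≤ 0)
    (hsym : ∀ i j, d i * a i j = d j * a j i) (hdpos : ∀ i, 0 < d i)
    (hfin : Matrix.PosDef (Matrix.of fun i j : Fin n => ((d i * a i j : ℤ) : ℝ)))
    (r s q : ℂ) (hr : r ≠ 0) (hs : s ≠ 0) (hq : q ≠ 0)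
    (hpar : r * s⁻¹ = q ^ 2) :
    (∃ t : ℂ, t ≠ 0 ∧
      (∀ μ ν lam : Fin n → ℤ,
        t ^ euler a d μ ν * t ^ euler a d (μ + ν) lam =
          t ^ euler a d ν lam * t ^ euler a d μ (ν + lam)) ∧
      IsGradedTwistIso a d t r s (q ^ 2) 1) ∧
    (∃ t : ℂ, t ≠ 0 ∧
      (∀ μ ν lam : Fin n → ℤ,
        t ^ euler a d μ ν * t ^ euler a d (μ + ν) lam =
          t ^ euler a d ν lam * t ^ euler a d μ (ν + lam)) ∧
      IsGradedTwistIso a d t r s q q⁻¹) ∧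
    (∃ t : ℂ, t ≠ 0 ∧
      (∀ μ ν lam : Fin n → ℤ,
        t ^ euler a d μ ν * t ^ euler a d (μ + ν) lam =
          t ^ euler a d ν lam * t ^ euler a d μ (ν + lam)) ∧
      IsGradedTwistIso a d t (q ^ 2) 1 q q⁻¹) := by
  have hrs : r = q ^ 2 * s := by rw [← hpar, inv_mul_cancel_right₀ hs]
  have hsq : s * q ≠ 0 := mul_ne_zero hs hq
  refine ⟨⟨s⁻¹, inv_ne_zero hs, zpow_euler_cocycle a d (inv_ne_zero hs), ?_⟩,
    ⟨(s * q)⁻¹, inv_ne_zero hsq, zpow_euler_cocycle a d (inv_ne_zero hsq), ?_⟩,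
    ⟨q⁻¹, inv_ne_zero hq, zpow_euler_cocycle a d (inv_ne_zero hq), ?_⟩⟩
  · exact isGradedTwistIso_of_rescale a d hs hrs (one_mul s).symm
  · exact isGradedTwistIso_of_rescale a d hsq (by rw [hrs]; ring) (by field_simp)
  · exact isGradedTwistIso_of_rescale a d hq (by ring) (inv_mul_cancel₀ hq).symm

end
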